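/- arXiv:1612.00617 — 2 statements merged into one kernel-verified Lean document; each statement's English description precedes it below -/
import Mathlib

section
/- For any n points x_1,…,x_n in [0,1]^d with n ≥ 250·d, the star-discrepancy satisfies D_n^*(x_1,…,x_n) ≥ d/(12n). -/
open scoped Classical

/-- The closed anchored axis-parallel box `[0,a_1] × ⋯ × [0,a_d]`. -/
def anchoredBox (d : ℕ) (a : Fin d → ℝ) : Set (Fin d → ℝ) :=
  {y | ∀ j, 0 ≤ y j ∧ y j ≤ a j}

/-- The star-discrepancy of the points `x 1, …, x n` in `[0,1]^d`. -/
noncomputable def starD (d n : ℕ) (x : Fin n → Fin d → ℝ) : ℝ :=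
  sSup {t : ℝ | ∃ a : Fin d → ℝ, (∀ j, a j ∈ Set.Icc (0:ℝ) 1) ∧
    t = |((Finset.univ.filter (fun k => x k ∈ anchoredBox d a)).card : ℝ) / n - ∏ j, a j|}

/-- The number of distinct subsets of `{x 1, …, x n}` cut out by anchored boxes. -/
noncomputable def interCount (d n : ℕ) (x : Fin n → Fin d → ℝ) : ℕ :=
  Set.ncard {P : Set (Fin d → ℝ) | ∃ a : Fin d → ℝ,
    (∀ j, a j ∈ Set.Icc (0:ℝ) 1) ∧ P = anchoredBox d a ∩ Set.range x}

/-- The number of points lying on the right upper boundary of the box `[0,a]`. -/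
noncomputable def boundaryCount (d n : ℕ) (x : Fin n → Fin d → ℝ) (a : Fin d → ℝ) : ℕ :=
  (Finset.univ.filter (fun k => x k ∈ anchoredBox d a ∧ ∃ j, x k j = a j)).card

/-- The corner simplex `{u ≥ 0 : ∑ u ≤ r}`. -/
def cornerSimplex (d : ℕ) (r : ℝ) : Set (Fin d → ℝ) :=
  {u | (∀ j, 0 ≤ u j) ∧ ∑ j, u j ≤ r}

theorem isClosed_cornerSimplex (d : ℕ) (r : ℝ) : IsClosed (cornerSimplex d r) := by
  have h : cornerSimplex d r = (⋂ j, {u | 0 ≤ u j}) ∩ {u | ∑ j, u j ≤ r} := by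
    ext u; simp [cornerSimplex]
  rw [h]
  exact (isClosed_iInter fun j => isClosed_le continuous_const (continuous_apply j)).inter
    (isClosed_le (by fun_prop) continuous_const)

open scoped Pointwise in
theorem cornerSimplex_eq_smul (d : ℕ) {r : ℝ} (hr : 0 < r) :
    cornerSimplex d r = r • cornerSimplex d 1 := by
  ext u
  rw [Set.mem_smul_set_iff_inv_smul_mem₀ hr.ne']
  simp only [cornerSimplex, Set.mem_ofPred_eq, Pi.smul_apply, smul_eq_mul, ← Finset.mul_sum]
  refine and_congr (forall_congr' fun j => ?_) ?_
  · rw [mul_nonneg_iff_of_pos_left (inv_pos.2 hr)]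
  · rw [inv_mul_le_iff₀ hr, mul_one]

theorem volume_cornerSimplex (d : ℕ) {r : ℝ} (hr : 0 < r) :
    MeasureTheory.volume.real (cornerSimplex d r) =
      r ^ d * MeasureTheory.volume.real (cornerSimplex d 1) := by
  rw [cornerSimplex_eq_smul d hr, MeasureTheory.measureReal_def, MeasureTheory.measureReal_def,
    MeasureTheory.Measure.addHaar_smul]
  simp [abs_of_pos (pow_pos hr d), ENNReal.toReal_mul, ENNReal.toReal_ofReal (pow_pos hr d).le]

theorem cornerSimplex_subset_Icc (d : ℕ) (r : ℝ) :
    cornerSimplex d r ⊆ Set.Icc 0 (fun _ => r) := by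
  rintro u ⟨h0, h1⟩
  exact ⟨h0, fun j => (Finset.single_le_sum (fun i _ => h0 i) (Finset.mem_univ j)).trans h1⟩

theorem volume_cornerSimplex_lt_top (d : ℕ) (r : ℝ) :
    MeasureTheory.volume (cornerSimplex d r) < ⊤ :=
  (MeasureTheory.measure_mono (cornerSimplex_subset_Icc d r)).trans_lt
    isCompact_Icc.measure_lt_top

theorem volume_cornerSimplex_one_pos (d : ℕ) :
    0 < MeasureTheory.volume.real (cornerSimplex d 1) := by
  refine ENNReal.toReal_pos (ne_of_gt ?_) (volume_cornerSimplex_lt_top d 1).ne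
  have hsub : Set.Icc (0 : Fin d → ℝ) (fun _ => 1 / ((d : ℝ) + 1)) ⊆ cornerSimplex d 1 := by
    rintro u ⟨h0, h1⟩
    refine ⟨h0, (Finset.sum_le_sum fun j _ => h1 j).trans ?_⟩
    have hd : (0 : ℝ) < d + 1 := by positivity
    simp only [Finset.sum_const, Finset.card_univ, Fintype.card_fin, nsmul_eq_mul]
    rw [mul_one_div, div_le_one hd]
    linarith
  refine lt_of_lt_of_le ?_ (MeasureTheory.measure_mono hsub)
  rw [Real.volume_Icc_pi]
  refine pos_iff_ne_zero.2 (Finset.prod_ne_zero_iff.2 fun j _ => ?_)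
  refine (ENNReal.ofReal_pos.2 ?_).ne'
  simp only [Pi.zero_apply, sub_zero]
  positivity

/-- Covering the unit corner simplex by reflected translates of a corner simplex of size `r`
takes at least `(1 / r) ^ d` translates. -/
theorem one_le_card_mul_pow_of_cover {ι : Type*} {d : ℕ} {r : ℝ} (hr : 0 < r) (F : Finset ι)
    (v : ι → Fin d → ℝ)
    (hcover : ∀ u ∈ cornerSimplex d 1, ∃ i ∈ F, v i - u ∈ cornerSimplex d r) :
    1 ≤ (F.card : ℝ) * r ^ d := by
  have hpre : ∀ i, MeasureTheory.volume ((fun u => v i - u) ⁻¹' cornerSimplex d r) =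
      MeasureTheory.volume (cornerSimplex d r) := fun i =>
    (MeasureTheory.Measure.measurePreserving_sub_left MeasureTheory.volume
      (v i)).measure_preimage (isClosed_cornerSimplex d r).measurableSet.nullMeasurableSet
  have hle : MeasureTheory.volume.real (cornerSimplex d 1) ≤
      ∑ i ∈ F, MeasureTheory.volume.real ((fun u => v i - u) ⁻¹' cornerSimplex d r) := by
    refine le_trans (MeasureTheory.measureReal_mono (fun u hu => ?_) ?_)
      (MeasureTheory.measureReal_biUnion_finset_le F
        fun i => (fun u => v i - u) ⁻¹' cornerSimplex d r)
    · simpa using hcover u hu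
    · exact (MeasureTheory.measure_biUnion_lt_top F.finite_toSet fun i _ =>
        (hpre i).trans_lt (volume_cornerSimplex_lt_top d r)).ne
  simp only [MeasureTheory.measureReal_def, hpre, Finset.sum_const, nsmul_eq_mul] at hle
  have hpos := volume_cornerSimplex_one_pos d
  simp only [← MeasureTheory.measureReal_def] at hle
  rw [volume_cornerSimplex d hr, ← mul_assoc] at hle
  exact le_of_mul_le_mul_right (by linarith) hpos

theorem abs_box_error_le_starD {d n : ℕ} (x : Fin n → Fin d → ℝ) {a : Fin d → ℝ}
    (ha : ∀ j, a j ∈ Set.Icc (0:ℝ) 1) :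
    |((Finset.univ.filter (fun k => x k ∈ anchoredBox d a)).card : ℝ) / n - ∏ j, a j| ≤
      starD d n x := by
  refine le_csSup ⟨1, ?_⟩ ⟨a, ha, rfl⟩
  rintro t ⟨b, hb, rfl⟩
  have h1 : ((Finset.univ.filter (fun k => x k ∈ anchoredBox d b)).card : ℝ) / n ≤ 1 := by
    refine div_le_one_of_le₀ ?_ (Nat.cast_nonneg n)
    exact_mod_cast (Finset.card_le_univ _).trans_eq (Fintype.card_fin n)
  have h2 : 0 ≤ ((Finset.univ.filter (fun k => x k ∈ anchoredBox d b)).card : ℝ) / n := by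
    positivity
  have h3 : ∏ j, b j ≤ 1 := Finset.prod_le_one (fun j _ => (hb j).1) fun j _ => (hb j).2
  have h4 : 0 ≤ ∏ j, b j := Finset.prod_nonneg fun j _ => (hb j).1
  rw [abs_le]
  constructor <;> linarith

theorem abs_interior_error_le_starD {d n : ℕ} (x : Fin n → Fin d → ℝ) {b : Fin d → ℝ}
    (hb0 : ∀ j, 0 < b j) (hb1 : ∀ j, b j ≤ 1) :
    |((Finset.univ.filter (fun k => ∀ j, 0 ≤ x k j ∧ x k j < b j)).card : ℝ) / n - ∏ j, b j| ≤
      starD d n x := by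
  have hlim : Filter.Tendsto (fun η : ℝ =>
      |((Finset.univ.filter (fun k => ∀ j, 0 ≤ x k j ∧ x k j < b j)).card : ℝ) / n
        - ∏ j, (b j - η)|) (nhdsWithin 0 (Set.Ioi 0))
      (nhds |((Finset.univ.filter (fun k => ∀ j, 0 ≤ x k j ∧ x k j < b j)).card : ℝ) / n
        - ∏ j, b j|) := by
    have hc : Continuous (fun η : ℝ =>
      |((Finset.univ.filter (fun k => ∀ j, 0 ≤ x k j ∧ x k j < b j)).card : ℝ) / n
        - ∏ j, (b j - η)|) := by fun_prop
    simpa using (hc.tendsto 0).mono_left nhdsWithin_le_nhds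
  refine le_of_tendsto hlim ?_
  have hlt : ∀ c : ℝ, 0 < c → ∀ᶠ η in nhdsWithin (0 : ℝ) (Set.Ioi 0), η < c := fun c hc =>
    nhdsWithin_le_nhds (eventually_lt_nhds hc)
  have hiff : ∀ᶠ η in nhdsWithin (0 : ℝ) (Set.Ioi 0), ∀ k j, x k j ≤ b j - η ↔ x k j < b j := by
    rw [Filter.eventually_all]; intro k
    rw [Filter.eventually_all]; intro j
    by_cases h : x k j < b j
    · filter_upwards [hlt _ (sub_pos.2 h)] with η hη
      simp only [h, iff_true]; linarith
    · filter_upwards [self_mem_nhdsWithin] with η hη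
      have := Set.mem_Ioi.1 hη
      simp only [h, iff_false]; intro; apply h; linarith
  have hpos : ∀ᶠ η in nhdsWithin (0 : ℝ) (Set.Ioi 0), ∀ j, η < b j :=
    Filter.eventually_all.2 fun j => hlt _ (hb0 j)
  filter_upwards [hiff, hpos, self_mem_nhdsWithin] with η h1 h2 h3
  have h3 := Set.mem_Ioi.1 h3
  have key := abs_box_error_le_starD x (a := fun j => b j - η)
    fun j => ⟨by linarith [h2 j], by linarith [hb1 j]⟩
  simpa only [anchoredBox, Set.mem_ofPred_eq, h1] using key

theorem boundaryCount_le {d n : ℕ} (hn : 0 < n) (x : Fin n → Fin d → ℝ) {b : Fin d → ℝ}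
    (hb0 : ∀ j, 0 < b j) (hb1 : ∀ j, b j ≤ 1) :
    (boundaryCount d n x b : ℝ) ≤ 2 * n * starD d n x := by
  have hclosed := abs_box_error_le_starD x (a := b) fun j => ⟨(hb0 j).le, hb1 j⟩
  have hopen := abs_interior_error_le_starD x hb0 hb1
  have hsplit : (Finset.univ.filter (fun k => x k ∈ anchoredBox d b)).card =
      boundaryCount d n x b +
        (Finset.univ.filter (fun k => ∀ j, 0 ≤ x k j ∧ x k j < b j)).card := by
    rw [← Finset.card_filter_add_card_filter_not (fun k => ∃ j, x k j = b j), boundaryCount,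
      Finset.filter_filter, Finset.filter_filter]
    congr 2
    ext k
    simp only [Finset.mem_filter, Finset.mem_univ, true_and, anchoredBox, Set.mem_ofPred_eq,
      not_exists, ← forall_and, and_assoc, lt_iff_le_and_ne, ne_eq]
  rw [hsplit, Nat.cast_add, add_div] at hclosed
  have h1 := (abs_le.1 hclosed).2
  have h2 := (abs_le.1 hopen).1
  have hn' : (0 : ℝ) < n := by exact_mod_cast hn
  have h3 : (boundaryCount d n x b : ℝ) / n ≤ 2 * starD d n x := by linarith
  rw [div_le_iff₀ hn'] at h3
  linarith

/-- The coordinatewise maximum of the points indexed by `B`. -/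
noncomputable def upperCorner {d n : ℕ} (x : Fin n → Fin d → ℝ) (B : Finset (Fin n)) :
    Fin d → ℝ :=
  fun j => sSup ((fun k => x k j) '' B)

theorem isGreatest_upperCorner {d n : ℕ} (x : Fin n → Fin d → ℝ) {B : Finset (Fin n)}
    (hB : B.Nonempty) (j : Fin d) :
    IsGreatest ((fun k => x k j) '' B) (upperCorner x B j) := by
  have hfin : ((fun k => x k j) '' (B : Set (Fin n))).Finite := B.finite_toSet.image _
  exact ⟨Set.Nonempty.csSup_mem (hB.to_set.image _) hfin,
    fun _ hy => le_csSup hfin.bddAbove hy⟩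

/-- A box of volume larger than twice the discrepancy contains an anchored box of almost the same
volume that is spanned by few points. -/
theorem exists_upperCorner_approx {d n : ℕ} (hd : 0 < d) (hn : 0 < n) (x : Fin n → Fin d → ℝ)
    (hx : ∀ k j, x k j ∈ Set.Icc (0:ℝ) 1) {a : Fin d → ℝ} (ha : ∀ j, a j ∈ Set.Icc (0:ℝ) 1)
    (hvol : 2 * starD d n x < ∏ j, a j) :
    ∃ B : Finset (Fin n), (B.card : ℝ) ≤ 2 * n * starD d n x ∧
      (∀ j, 0 < upperCorner x B j) ∧ (∀ j, upperCorner x B j ≤ a j) ∧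
      ∏ j, a j ≤ ∏ j, upperCorner x B j + 2 * starD d n x := by
  have hea := abs_le.1 (abs_box_error_le_starD x ha)
  set I := Finset.univ.filter (fun k => x k ∈ anchoredBox d a) with hI
  have hInonempty : I.Nonempty := by
    rw [← Finset.card_pos, Nat.pos_iff_ne_zero]
    intro h0
    rw [h0, Nat.cast_zero, zero_div] at hea
    linarith [hea.1, hea.2]
  set b := upperCorner x I with hb
  have hgreat := isGreatest_upperCorner x hInonempty
  have hub : ∀ k ∈ I, ∀ j, x k j ≤ b j := fun k hk j => (hgreat j).2 ⟨k, hk, rfl⟩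
  have hatt : ∀ j, ∃ k ∈ I, x k j = b j := fun j => by
    obtain ⟨k, hk, h⟩ := (hgreat j).1
    exact ⟨k, hk, h⟩
  have hba : ∀ j, b j ≤ a j := fun j => by
    obtain ⟨k, hk, h⟩ := hatt j
    rw [← h]
    exact ((Finset.mem_filter.1 hk).2 j).2
  have hb0 : ∀ j, 0 ≤ b j := fun j => by
    obtain ⟨k, -, h⟩ := hatt j
    exact h ▸ (hx k j).1
  have hbox : Finset.univ.filter (fun k => x k ∈ anchoredBox d b) = I := by
    ext k
    constructor
    · intro hk
      exact Finset.mem_filter.2 ⟨Finset.mem_univ k, fun j =>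
        ⟨(hx k j).1, ((Finset.mem_filter.1 hk).2 j).2.trans (hba j)⟩⟩
    · intro hk
      exact Finset.mem_filter.2 ⟨Finset.mem_univ k, fun j => ⟨(hx k j).1, hub k hk j⟩⟩
  have heb := abs_le.1 (abs_box_error_le_starD x (a := b)
    fun j => ⟨hb0 j, (hba j).trans (ha j).2⟩)
  rw [hbox] at heb
  have hprod : ∏ j, a j ≤ ∏ j, b j + 2 * starD d n x := by linarith [hea.1, heb.2]
  have hbpos : ∀ j, 0 < b j := fun j => (hb0 j).lt_of_ne' fun h => by
    rw [Finset.prod_eq_zero (Finset.mem_univ j) h] at hprod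
    linarith
  have hcount := boundaryCount_le hn x hbpos fun j => (hba j).trans (ha j).2
  rw [boundaryCount, ← Finset.filter_filter, hbox] at hcount
  set B := I.filter (fun k => ∃ j, x k j = b j) with hB
  have hBne : B.Nonempty := by
    obtain ⟨k, hk, h⟩ := hatt ⟨0, hd⟩
    exact ⟨k, Finset.mem_filter.2 ⟨hk, _, h⟩⟩
  have hBb : upperCorner x B = b := by
    funext j
    refine (isGreatest_upperCorner x hBne j).unique ⟨?_, ?_⟩
    · obtain ⟨k, hk, h⟩ := hatt j
      exact ⟨k, Finset.mem_filter.2 ⟨hk, j, h⟩, h⟩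
    · rintro _ ⟨k, hk, rfl⟩
      exact hub k (Finset.mem_filter.1 hk).1 j
  exact ⟨B, hcount, hBb ▸ hbpos, hBb ▸ hba, hBb ▸ hprod⟩

/-- There are at most `e ^ s * (n / s) ^ m` subsets of size at most `m`, for `0 < s ≤ n`. -/
theorem card_filter_card_le {n m : ℕ} {s : ℝ} (hs : 0 < s) (hsn : s ≤ n) :
    ((Finset.univ.filter (fun B : Finset (Fin n) => B.card ≤ m)).card : ℝ) ≤
      Real.exp s * (n / s) ^ m := by
  have hn : (0 : ℝ) < n := hs.trans_le hsn
  have hy0 : 0 < s / n := by positivity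
  have hy1 : s / n ≤ 1 := (div_le_one hn).2 hsn
  have hsum : ∑ B : Finset (Fin n), (s / n) ^ B.card = (s / n + 1) ^ n := by
    have h := Finset.sum_pow_mul_eq_add_pow (s / n) 1 (Finset.univ : Finset (Fin n))
    simpa using h
  have hle : ((Finset.univ.filter (fun B : Finset (Fin n) => B.card ≤ m)).card : ℝ) * (s / n) ^ m
      ≤ Real.exp s :=
    calc _ = ∑ B ∈ Finset.univ.filter (fun B : Finset (Fin n) => B.card ≤ m), (s / n) ^ m := by
          rw [Finset.sum_const, nsmul_eq_mul]
      _ ≤ ∑ B ∈ Finset.univ.filter (fun B : Finset (Fin n) => B.card ≤ m), (s / n) ^ B.card :=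
          Finset.sum_le_sum fun B hB =>
            pow_le_pow_of_le_one hy0.le hy1 (Finset.mem_filter.1 hB).2
      _ ≤ ∑ B : Finset (Fin n), (s / n) ^ B.card :=
          Finset.sum_le_sum_of_subset_of_nonneg (Finset.filter_subset _ _)
            fun _ _ _ => by positivity
      _ = (s / n + 1) ^ n := hsum
      _ ≤ Real.exp (s / n) ^ n := by gcongr; exact Real.add_one_le_exp _
      _ = Real.exp s := by rw [← Real.exp_nat_mul, mul_div_cancel₀ _ hn.ne']
  rw [← le_div_iff₀ (by positivity)] at hle
  rwa [← inv_div, inv_pow, ← div_eq_mul_inv]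

/-- If the discrepancy is small, the logarithmic corners of boxes spanned by few points cover the
unit corner simplex. -/
theorem exists_cover_of_starD_lt {d n : ℕ} (hd : 0 < d) (hn : 250 * d ≤ n)
    (x : Fin n → Fin d → ℝ) (hx : ∀ k j, x k j ∈ Set.Icc (0:ℝ) 1)
    (hD : starD d n x < (d : ℝ) / (12 * n)) {u : Fin d → ℝ} (hu : u ∈ cornerSimplex d 1) :
    ∃ B ∈ Finset.univ.filter (fun B : Finset (Fin n) => B.card ≤ d / 2),
      (fun j => -Real.log (upperCorner x B j)) - u ∈ cornerSimplex d (d / (2 * n)) := by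
  have hn0 : 0 < n := by omega
  have hnR : (0 : ℝ) < n := by exact_mod_cast hn0
  have hdR : (0 : ℝ) < d := by exact_mod_cast hd
  have hdn : (250 : ℝ) * d ≤ n := by exact_mod_cast hn
  set q : ℝ := d / n with hq
  have hqn : q * n = d := div_mul_cancel₀ _ hnR.ne'
  have hq0 : 0 < q := by positivity
  have hq1 : q ≤ 1 / 250 := by rw [hq, div_le_iff₀ hnR]; linarith
  have hDq : 2 * starD d n x < q / 6 := by
    have h : (d : ℝ) / (12 * n) = q / 12 := by rw [hq]; field_simp
    linarith
  have hτ : (d : ℝ) / (2 * n) = q / 2 := by rw [hq]; field_simp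
  have hprod : ∏ j, Real.exp (-u j) = Real.exp (-∑ j, u j) := by
    rw [← Real.exp_sum, Finset.sum_neg_distrib]
  have hvol : (0.36 : ℝ) ≤ ∏ j, Real.exp (-u j) := by
    rw [hprod]
    refine le_trans ?_ (Real.exp_le_exp.2 (neg_le_neg hu.2))
    linarith [Real.exp_neg_one_gt_d9]
  obtain ⟨B, hcard, hpos, hle, hapx⟩ := exists_upperCorner_approx hd hn0 x hx
    (a := fun j => Real.exp (-u j))
    (fun j => ⟨(Real.exp_pos _).le, Real.exp_le_one_iff.2 (neg_nonpos.2 (hu.1 j))⟩)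
    (by linarith)
  refine ⟨B, Finset.mem_filter.2 ⟨Finset.mem_univ B, ?_⟩, fun j => ?_, ?_⟩
  · have h : (B.card : ℝ) * 2 ≤ d := by nlinarith
    rw [Nat.le_div_iff_mul_le two_pos]
    exact_mod_cast h
  · have h := Real.log_le_log (hpos j) (hle j)
    rw [Real.log_exp] at h
    simp only [Pi.sub_apply]
    linarith
  · have hbpos : 0 < ∏ j, upperCorner x B j := Finset.prod_pos fun j _ => hpos j
    have hratio : Real.log (∏ j, Real.exp (-u j)) - Real.log (∏ j, upperCorner x B j) ≤ q / 2 := by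
      rw [← Real.log_div (by linarith) hbpos.ne']
      refine (Real.log_le_sub_one_of_pos (div_pos (by linarith) hbpos)).trans ?_
      rw [sub_le_iff_le_add, div_le_iff₀ hbpos]
      nlinarith
    rw [hprod, Real.log_exp, Real.log_prod fun j _ => (hpos j).ne'] at hratio
    simp only [Pi.sub_apply, Finset.sum_sub_distrib, Finset.sum_neg_distrib]
    linarith

theorem discrepancy_lower_main (d n : ℕ) (hn : 250 * d ≤ n)
    (x : Fin n → Fin d → ℝ) (hx : ∀ k j, x k j ∈ Set.Icc (0:ℝ) 1) :
    starD d n x ≥ (d : ℝ) / (12 * n) := by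
  by_contra! hD
  rcases Nat.eq_zero_or_pos d with rfl | hd
  · have h := (abs_nonneg _).trans
      (abs_box_error_le_starD x (a := fun _ => 1) fun _ => ⟨zero_le_one, le_rfl⟩)
    simp only [Nat.cast_zero, zero_div] at hD
    linarith
  have hdR : (0 : ℝ) < d := by exact_mod_cast hd
  have hdn : (250 : ℝ) * d ≤ n := by exact_mod_cast hn
  have hnR : (0 : ℝ) < n := by linarith
  have hcover := one_le_card_mul_pow_of_cover (by positivity) _ _
    fun u hu => exists_cover_of_starD_lt hd hn x hx hD hu
  have hcard := card_filter_card_le (n := n) (m := d / 2) hdR (by linarith)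
  set N : ℝ := n / d with hN
  have hN250 : 250 ≤ N := by rw [hN, le_div_iff₀ hdR]; linarith
  have hr : (d : ℝ) / (2 * n) = (2 * N)⁻¹ := by rw [hN]; field_simp
  rw [hr, inv_pow, ← div_eq_mul_inv, one_le_div (by positivity)] at hcover
  have hexp : Real.exp (d : ℝ) ≤ 3 ^ d := by
    rw [← mul_one (d : ℝ), Real.exp_nat_mul]
    gcongr
    linarith [Real.exp_one_lt_d9]
  have hmain : (2 * N) ^ d ≤ 3 ^ d * N ^ (d / 2) :=
    hcover.trans (hcard.trans (by gcongr))
  have hsq : (4 * N ^ 2) ^ d ≤ (9 * N) ^ d :=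
    calc (4 * N ^ 2) ^ d = ((2 * N) ^ d) ^ 2 := by rw [← pow_mul, mul_comm d 2, pow_mul]; ring
      _ ≤ (3 ^ d * N ^ (d / 2)) ^ 2 := by gcongr
      _ = (3 ^ 2) ^ d * N ^ (d / 2 * 2) := by
          rw [mul_pow, ← pow_mul, ← pow_mul, ← pow_mul, mul_comm 2 d]
      _ ≤ (3 ^ 2) ^ d * N ^ d := by
          gcongr
          · linarith
          · exact Nat.div_mul_le_self d 2
      _ = (9 * N) ^ d := by rw [mul_pow]; norm_num
  have hlt : (9 * N) ^ d < (4 * N ^ 2) ^ d :=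
    pow_lt_pow_left₀ (by nlinarith) (by positivity) hd.ne'
  linarith
end

section
/- For every ε with 0 < ε < 1/3000 and every d ≥ 1, any point set in [0,1]^d with star-discrepancy at most ε has at least d·ε^{-1}/12 points; i.e., the inverse of the star-discrepancy satisfies n^*(ε,d) ≥ d·ε^{-1}/12. -/
open scoped Classical

/-- The indices of the points lying in the box `[0,a]`. -/
noncomputable def boxIndices {d n : ℕ} (x : Fin n → Fin d → ℝ) (a : Fin d → ℝ) : Finset (Fin n) :=
  Finset.univ.filter (fun k => x k ∈ anchoredBox d a)

/-- The indices of the points lying on the right upper boundary of the box `[0,a]`. -/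
noncomputable def boundaryIndices {d n : ℕ} (x : Fin n → Fin d → ℝ) (a : Fin d → ℝ) :
    Finset (Fin n) :=
  Finset.univ.filter (fun k => x k ∈ anchoredBox d a ∧ ∃ j, x k j = a j)

lemma mem_boxIndices {d n : ℕ} {x : Fin n → Fin d → ℝ} {a : Fin d → ℝ} {k : Fin n} :
    k ∈ boxIndices x a ↔ ∀ j, 0 ≤ x k j ∧ x k j ≤ a j :=
  Finset.mem_filter.trans (and_iff_right (Finset.mem_univ k))

lemma mem_boundaryIndices {d n : ℕ} {x : Fin n → Fin d → ℝ} {a : Fin d → ℝ} {k : Fin n} :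
    k ∈ boundaryIndices x a ↔ (∀ j, 0 ≤ x k j ∧ x k j ≤ a j) ∧ ∃ j, x k j = a j :=
  Finset.mem_filter.trans (and_iff_right (Finset.mem_univ k))

lemma boundaryIndices_subset_boxIndices {d n : ℕ} (x : Fin n → Fin d → ℝ) (a : Fin d → ℝ) :
    boundaryIndices x a ⊆ boxIndices x a :=
  fun _ hk => mem_boxIndices.mpr (mem_boundaryIndices.mp hk).1

/-- The coordinatewise supremum of the points indexed by `s`. -/
noncomputable def corner {d n : ℕ} (x : Fin n → Fin d → ℝ) (s : Finset (Fin n)) : Fin d → ℝ :=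
  fun j => if h : s.Nonempty then s.sup' h (fun k => x k j) else 0

/-- The local discrepancy is bounded by the star-discrepancy. -/
lemma abs_local_discrepancy_le_starD {d n : ℕ} (x : Fin n → Fin d → ℝ) {a : Fin d → ℝ}
    (ha : ∀ j, a j ∈ Set.Icc (0:ℝ) 1) :
    |((boxIndices x a).card : ℝ) / n - ∏ j, a j| ≤ starD d n x := by
  refine le_csSup ⟨1, ?_⟩ ⟨a, ha, rfl⟩
  rintro t ⟨b, hb, rfl⟩
  have h0 : 0 ≤ ∏ j, b j := Finset.prod_nonneg fun j _ => (hb j).1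
  have h1 : ∏ j, b j ≤ 1 := Finset.prod_le_one (fun j _ => (hb j).1) fun j _ => (hb j).2
  have h2 : ((Finset.univ.filter (fun k => x k ∈ anchoredBox d b)).card : ℝ) / n ≤ 1 := by
    refine div_le_one_of_le₀ ?_ n.cast_nonneg
    exact_mod_cast (Finset.card_le_univ _).trans_eq (Fintype.card_fin n)
  have h3 : (0:ℝ) ≤ ((Finset.univ.filter (fun k => x k ∈ anchoredBox d b)).card : ℝ) / n := by
    positivity
  rw [abs_le]
  constructor <;> linarith

/-- A box contains at most `2 n D` points on its right upper boundary. -/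
lemma card_boundaryIndices_le {d n : ℕ} (hn : 0 < n) {x : Fin n → Fin d → ℝ} {ε : ℝ}
    (hdisc : starD d n x ≤ ε) {a : Fin d → ℝ} (ha : ∀ j, a j ∈ Set.Icc (0:ℝ) 1) :
    ((boundaryIndices x a).card : ℝ) ≤ 2 * ε * n := by
  have hn' : (0:ℝ) < n := by exact_mod_cast hn
  have hsub := boundaryIndices_subset_boxIndices x a
  have hA := (abs_le.mp ((abs_local_discrepancy_le_starD x ha).trans hdisc)).2
  have hA' : ((boxIndices x a).card : ℝ) ≤ (ε + ∏ j, a j) * n := by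
    rw [← div_le_iff₀ hn']; linarith
  by_cases h0 : ∃ j, a j = 0
  · obtain ⟨j, hj⟩ := h0
    rw [Finset.prod_eq_zero (Finset.mem_univ j) hj] at hA'
    have : ((boundaryIndices x a).card : ℝ) ≤ (boxIndices x a).card := by
      exact_mod_cast Finset.card_le_card hsub
    linarith [(Nat.cast_nonneg _ : (0:ℝ) ≤ (boundaryIndices x a).card)]
  push Not at h0
  have hpos : ∀ j, 0 < a j := fun j => lt_of_le_of_ne (ha j).1 (h0 j).symm
  have key : ∀ h : ℝ, 0 < h → h ≤ 1 →
      ((boundaryIndices x a).card : ℝ) ≤ 2 * ε * n + h * (d * n) := by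
    intro h hh hh1
    set b : Fin d → ℝ := fun j => (1 - h) * a j with hb
    have hbm : ∀ j, b j ∈ Set.Icc (0:ℝ) 1 := fun j => by
      simp only [hb, Set.mem_Icc]
      constructor <;> nlinarith [(ha j).1, (ha j).2]
    have hB := (abs_le.mp ((abs_local_discrepancy_le_starD x hbm).trans hdisc)).1
    have hB' : (∏ j, b j - ε) * n ≤ ((boxIndices x b).card : ℝ) := by
      rw [← le_div_iff₀ hn']; linarith
    have hprod : ∏ j, b j = (1 - h) ^ d * ∏ j, a j := by
      simp [hb, Finset.prod_mul_distrib]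
    have hbern : 1 - d * h ≤ (1 - h) ^ d := by
      have := one_add_mul_le_pow (a := -h) (by linarith) d
      calc 1 - d * h = 1 + d * (-h) := by ring
        _ ≤ (1 + -h) ^ d := this
        _ = _ := by rw [← sub_eq_add_neg]
    have hdisj : Disjoint (boundaryIndices x a) (boxIndices x b) := by
      rw [Finset.disjoint_left]
      intro k hk hk'
      obtain ⟨_, j, hj⟩ := mem_boundaryIndices.mp hk
      have := (mem_boxIndices.mp hk' j).2
      simp only [hb] at this
      nlinarith [hpos j, mul_pos hh (hpos j)]
    have hsub' : boundaryIndices x a ∪ boxIndices x b ⊆ boxIndices x a := by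
      refine Finset.union_subset hsub fun k hk => ?_
      rw [mem_boxIndices] at hk ⊢
      refine fun j => ⟨(hk j).1, (hk j).2.trans ?_⟩
      simp only [hb]
      nlinarith [hpos j, mul_pos hh (hpos j)]
    have hcard : ((boundaryIndices x a).card : ℝ) + (boxIndices x b).card
        ≤ (boxIndices x a).card := by
      have := Finset.card_le_card hsub'
      rw [Finset.card_union_of_disjoint hdisj] at this
      exact_mod_cast this
    have hv0 : 0 ≤ ∏ j, a j := Finset.prod_nonneg fun j _ => (ha j).1
    have hv1 : ∏ j, a j ≤ 1 := Finset.prod_le_one (fun j _ => (ha j).1) fun j _ => (ha j).2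
    have hgap : ∏ j, a j - ∏ j, b j ≤ h * d := by
      rw [hprod]
      have hdh : 0 ≤ d * h := by positivity
      nlinarith [mul_le_mul_of_nonneg_right hbern hv0]
    nlinarith [mul_le_mul_of_nonneg_right hgap hn'.le]
  refine le_of_forall_pos_le_add fun η hη => ?_
  have hM : (0:ℝ) < d * n + 1 := by positivity
  have hle := key (min 1 (η / (d * n + 1))) (by positivity) (min_le_left _ _)
  have : min 1 (η / (d * n + 1)) * (d * n : ℝ) ≤ η :=
    calc min 1 (η / (d * n + 1)) * (d * n : ℝ) ≤ η / (d * n + 1) * (d * n + 1) := by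
          gcongr
          · exact min_le_right _ _
          · linarith
      _ = η := div_mul_cancel₀ _ hM.ne'
  linarith

lemma corner_mem_Icc {d n : ℕ} {x : Fin n → Fin d → ℝ} (hx : ∀ k j, x k j ∈ Set.Icc (0:ℝ) 1)
    (s : Finset (Fin n)) (j : Fin d) : corner x s j ∈ Set.Icc (0:ℝ) 1 := by
  unfold corner
  split_ifs with h
  · obtain ⟨k, hk, hkj⟩ := Finset.exists_mem_eq_sup' h (fun k => x k j)
    rw [hkj]
    exact hx k j
  · simp

/-- The points of a box are exactly those below their own coordinatewise supremum. -/
lemma boxIndices_corner {d n : ℕ} {x : Fin n → Fin d → ℝ} {a : Fin d → ℝ} (ha : ∀ j, 0 ≤ a j) :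
    boxIndices x (corner x (boxIndices x a)) = boxIndices x a := by
  ext k
  constructor
  · intro hk
    rw [mem_boxIndices] at hk ⊢
    refine fun j => ⟨(hk j).1, (hk j).2.trans ?_⟩
    unfold corner
    split_ifs with h
    · exact Finset.sup'_le _ _ fun i hi => (mem_boxIndices.mp hi j).2
    · exact ha j
  · intro hk
    refine mem_boxIndices.mpr fun j => ⟨?_, ?_⟩
    · exact (mem_boxIndices.mp hk j).1
    · rw [corner, dif_pos ⟨k, hk⟩]
      exact Finset.le_sup' (fun i => x i j) hk

/-- The coordinatewise supremum of the points of a box is determined by the points on the boundary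
of the smallest box containing them. -/
lemma corner_boundaryIndices {d n : ℕ} (hd : 1 ≤ d) {x : Fin n → Fin d → ℝ} {a : Fin d → ℝ}
    (ha : ∀ j, 0 ≤ a j) :
    corner x (boundaryIndices x (corner x (boxIndices x a))) = corner x (boxIndices x a) := by
  set m := corner x (boxIndices x a) with hm
  have hbox : boxIndices x m = boxIndices x a := boxIndices_corner ha
  have hsub : boundaryIndices x m ⊆ boxIndices x a :=
    (boundaryIndices_subset_boxIndices x m).trans hbox.subset
  by_cases h : (boxIndices x a).Nonempty
  · have hatt : ∀ j, ∃ k ∈ boundaryIndices x m, x k j = m j := by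
      intro j
      obtain ⟨k, hk, hkj⟩ := Finset.exists_mem_eq_sup' h (fun k => x k j)
      have hkm : x k j = m j := by rw [hm, corner, dif_pos h, hkj]
      refine ⟨k, ?_, hkm⟩
      rw [← hbox] at hk
      exact mem_boundaryIndices.mpr ⟨mem_boxIndices.mp hk, j, hkm⟩
    have hne : (boundaryIndices x m).Nonempty := by
      obtain ⟨k, hk, _⟩ := hatt ⟨0, hd⟩
      exact ⟨k, hk⟩
    funext j
    rw [corner, dif_pos hne]
    apply le_antisymm
    · refine Finset.sup'_le _ _ fun k hk => ?_
      exact ((mem_boundaryIndices.mp hk).1 j).2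
    · obtain ⟨k, hk, hkj⟩ := hatt j
      rw [← hkj]
      exact Finset.le_sup' (fun i => x i j) hk
  · have hne : ¬ (boundaryIndices x m).Nonempty := fun ⟨k, hk⟩ => h ⟨k, hsub hk⟩
    funext j
    rw [hm] at hne
    simp only [hm, corner, dif_neg h]
    rw [dif_neg]
    convert hne using 4

/-- A family of subsets of `Fin n` of size at most `t * n` has at most `(e / t) ^ (t * n)` members,
where `0 < t ≤ 1`. -/
lemma card_le_of_forall_card_le {n : ℕ} {t : ℝ} (ht0 : 0 < t) (ht1 : t ≤ 1)
    (F : Finset (Finset (Fin n))) (hF : ∀ s ∈ F, (s.card : ℝ) ≤ t * n) :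
    (F.card : ℝ) ≤ (Real.exp 1 / t) ^ (t * n) := by
  have h1 : (F.card : ℝ) * t ^ (t * n) ≤ (1 + t) ^ n := by
    calc (F.card : ℝ) * t ^ (t * n) = ∑ _s ∈ F, t ^ (t * n) := by simp
      _ ≤ ∑ s ∈ F, t ^ s.card := by
          refine Finset.sum_le_sum fun s hs => ?_
          rw [← Real.rpow_natCast]
          exact Real.rpow_le_rpow_of_exponent_ge ht0 ht1 (hF s hs)
      _ ≤ ∑ s : Finset (Fin n), t ^ s.card :=
          Finset.sum_le_univ_sum_of_nonneg fun s => by positivity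
      _ = (1 + t) ^ n := by
          have := Fin.sum_pow_mul_eq_add_pow t 1 (n := n)
          simp only [one_pow, mul_one] at this
          rw [this, add_comm]
  have h2 : (1 + t) ^ n ≤ Real.exp 1 ^ (t * n) := by
    rw [Real.exp_one_rpow, mul_comm, Real.exp_nat_mul]
    gcongr
    linarith [Real.add_one_le_exp t]
  rw [Real.div_rpow (Real.exp_pos 1).le ht0.le, le_div_iff₀ (by positivity)]
  exact h1.trans h2

/-- The point `exp (-k / c)`, coordinatewise. -/
noncomputable def gridPoint {d : ℕ} (c : ℝ) (k : Fin d → ℕ) : Fin d → ℝ :=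
  fun j => Real.exp (-(k j / c))

lemma gridPoint_mem_Icc {d : ℕ} {c : ℝ} (hc : 0 ≤ c) (k : Fin d → ℕ) (j : Fin d) :
    gridPoint c k j ∈ Set.Icc (0:ℝ) 1 := by
  refine ⟨(Real.exp_pos _).le, Real.exp_le_one_iff.mpr ?_⟩
  have : 0 ≤ (k j : ℝ) / c := by positivity
  linarith

lemma prod_gridPoint {d : ℕ} (c : ℝ) (k : Fin d → ℕ) :
    ∏ j, gridPoint c k j = Real.exp (-((∑ j, (k j : ℝ)) / c)) := by
  simp only [gridPoint, ← Real.exp_sum, Finset.sum_neg_distrib, Finset.sum_div]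

/-- The number of `k ≤ m` with `∑ (m - k) ≤ d` is at most `4 ^ d`. -/
lemma card_le_four_pow {d : ℕ} (m : Fin d → ℕ) (G : Finset (Fin d → ℕ))
    (hle : ∀ k ∈ G, ∀ j, k j ≤ m j) (hsum : ∀ k ∈ G, ∑ j, (m j - k j) ≤ d) :
    (G.card : ℝ) ≤ 4 ^ d := by
  have hgeom : ∀ N : ℕ, ∑ i ∈ Finset.range (N + 1), (1 / 2 : ℝ) ^ (N - i) ≤ 2 := by
    intro N
    have := Finset.sum_range_reflect (fun i => (1 / 2 : ℝ) ^ i) (N + 1)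
    simp only [Nat.add_sub_cancel] at this
    rw [this]
    exact sum_geometric_two_le _
  calc (G.card : ℝ) = ∑ _k ∈ G, (1 : ℝ) := by simp
    _ ≤ ∑ k ∈ G, 2 ^ d * ∏ j, (1 / 2 : ℝ) ^ (m j - k j) := by
        refine Finset.sum_le_sum fun k hk => ?_
        rw [Finset.prod_pow_eq_pow_sum]
        calc (1 : ℝ) = 2 ^ d * (1 / 2) ^ d := by rw [← mul_pow]; norm_num
          _ ≤ _ := by
            gcongr 2 ^ d * ?_
            exact pow_le_pow_of_le_one (by norm_num) (by norm_num) (hsum k hk)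
    _ ≤ ∑ k ∈ Fintype.piFinset (fun j => Finset.range (m j + 1)),
          2 ^ d * ∏ j, (1 / 2 : ℝ) ^ (m j - k j) := by
        refine Finset.sum_le_sum_of_subset_of_nonneg (fun k hk => ?_) fun k _ _ => by positivity
        rw [Fintype.mem_piFinset]
        exact fun j => Finset.mem_range.mpr (Nat.lt_succ_of_le (hle k hk j))
    _ = 2 ^ d * ∏ j, ∑ i ∈ Finset.range (m j + 1), (1 / 2 : ℝ) ^ (m j - i) := by
        rw [← Finset.mul_sum, Finset.prod_univ_sum]
    _ ≤ 2 ^ d * ∏ _j : Fin d, (2 : ℝ) := by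
        gcongr with j
        exact hgeom (m j)
    _ = 4 ^ d := by rw [Finset.prod_const, Finset.card_univ, Fintype.card_fin, ← mul_pow]; norm_num

/-- At most `4 ^ d` boxes of the logarithmic grid cut out the same set of points. -/
lemma card_gridPoint_fiber_le {d n q : ℕ} (hd : 1 ≤ d) (hq : 0 < q) {x : Fin n → Fin d → ℝ}
    {ε : ℝ} (hqε : 6 * ε * q ≤ 1) (hdisc : starD d n x ≤ ε) (P : Finset (Fin n)) :
    (((Fintype.piFinset (fun _ : Fin d => Finset.range (q + 1))).filter
      (fun k => boxIndices x (gridPoint (q * d) k) = P)).card : ℝ) ≤ 4 ^ d := by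
  set G := (Fintype.piFinset (fun _ : Fin d => Finset.range (q + 1))).filter
    (fun k => boxIndices x (gridPoint (q * d) k) = P) with hG
  set c : ℝ := q * d with hc
  have hc0 : 0 < c := by positivity
  rcases G.eq_empty_or_nonempty with h | hne
  · rw [h]; simp
  have hmem : ∀ k ∈ G, (∀ j, k j ≤ q) ∧ boxIndices x (gridPoint c k) = P := fun k hk => by
    simpa [hG, Fintype.mem_piFinset, Nat.lt_succ_iff] using hk
  choose w hwG hw using fun j => Finset.exists_max_image G (fun k => k j) hne
  set m : Fin d → ℕ := fun j => w j j with hm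
  have hle : ∀ k ∈ G, ∀ j, k j ≤ m j := fun k hk j => hw j k hk
  have hmP : boxIndices x (gridPoint c m) = P := by
    ext i
    constructor
    · intro hi
      obtain ⟨k, hk⟩ := hne
      rw [← (hmem k hk).2]
      refine mem_boxIndices.mpr fun j => ?_
      have hij := mem_boxIndices.mp hi j
      refine ⟨hij.1, hij.2.trans ?_⟩
      have := hle k hk j
      simp only [gridPoint]
      gcongr
    · intro hi
      refine mem_boxIndices.mpr fun j => ?_
      rw [← (hmem (w j) (hwG j)).2] at hi
      exact mem_boxIndices.mp hi j
  refine card_le_four_pow m G hle fun k hk => ?_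
  have h1 := abs_le.mp
    ((abs_local_discrepancy_le_starD x (gridPoint_mem_Icc hc0.le k)).trans hdisc)
  have h2 := abs_le.mp
    ((abs_local_discrepancy_le_starD x (gridPoint_mem_Icc hc0.le m)).trans hdisc)
  rw [(hmem k hk).2, prod_gridPoint] at h1
  rw [hmP, prod_gridPoint] at h2
  have hgap : Real.exp (-((∑ j, (k j : ℝ)) / c)) - Real.exp (-((∑ j, (m j : ℝ)) / c)) ≤ 2 * ε := by
    linarith [h1.1, h2.2]
  set s : ℝ := ((∑ j, (m j - k j) : ℕ) : ℝ) with hs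
  have hs' : s = ∑ j, (m j : ℝ) - ∑ j, (k j : ℝ) := by
    rw [hs, Nat.cast_sum, ← Finset.sum_sub_distrib]
    exact Finset.sum_congr rfl fun j _ => Nat.cast_sub (hle k hk j)
  have hexp : Real.exp (-((∑ j, (k j : ℝ)) / c))
      = Real.exp (-((∑ j, (m j : ℝ)) / c)) * Real.exp (s / c) := by
    rw [← Real.exp_add, hs']
    congr 1
    ring
  have hmc : (∑ j, (m j : ℝ)) / c ≤ 1 := by
    rw [div_le_one hc0, hc]
    calc ∑ j, (m j : ℝ) ≤ ∑ _j : Fin d, (q : ℝ) := by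
          refine Finset.sum_le_sum fun j _ => ?_
          exact_mod_cast (hmem (w j) (hwG j)).1 j
      _ = q * d := by simp [mul_comm]
  have hV : 1 / 3 ≤ Real.exp (-((∑ j, (m j : ℝ)) / c)) := by
    calc (1:ℝ) / 3 ≤ (Real.exp 1)⁻¹ := by
          rw [one_div]
          exact inv_anti₀ (Real.exp_pos 1) (by linarith [Real.exp_one_lt_d9])
      _ = Real.exp (-1) := (Real.exp_neg 1).symm
      _ ≤ _ := Real.exp_le_exp.mpr (by linarith)
  have hs0 : 0 ≤ s / c := by positivity
  have hle1 := Real.add_one_le_exp (s / c)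
  have hsc : s / c ≤ 6 * ε := by
    rw [hexp] at hgap
    nlinarith [mul_le_mul hV (show s / c ≤ Real.exp (s / c) - 1 by linarith) hs0
      (Real.exp_pos _).le]
  have hsd : s ≤ d := by
    rw [div_le_iff₀ hc0, hc] at hsc
    nlinarith [(Nat.cast_nonneg d : (0:ℝ) ≤ d)]
  exact Nat.cast_le.mp hsd

theorem inverse_discrepancy (ε : ℝ) (hε0 : 0 < ε) (hε1 : ε < 1/3000) (d : ℕ) (hd : 1 ≤ d)
    (n : ℕ) (x : Fin n → Fin d → ℝ) (hx : ∀ k j, x k j ∈ Set.Icc (0:ℝ) 1)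
    (hdisc : starD d n x ≤ ε) :
    (d : ℝ) * ε⁻¹ / 12 ≤ n := by
  by_contra! hlt
  have hn : 0 < n := by
    rcases Nat.eq_zero_or_pos n with rfl | h
    · have := (abs_local_discrepancy_le_starD x (a := fun _ => 1) (by simp)).trans hdisc
      norm_num at this
      linarith
    · exact h
  have hsmall : 12 * ε * n < d := by
    rw [lt_div_iff₀ (by norm_num), ← div_eq_mul_inv, lt_div_iff₀ hε0] at hlt
    linarith
  set q := ⌊1 / (6 * ε)⌋₊ with hq
  have hq_le : (q : ℝ) ≤ 1 / (6 * ε) := Nat.floor_le (by positivity)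
  have hq_lt : 1 / (6 * ε) < q + 1 := Nat.lt_floor_add_one _
  have hq0 : 0 < q := by
    refine Nat.floor_pos.mpr ?_
    rw [le_div_iff₀ (by positivity)]
    linarith
  have hqε : 6 * ε * q ≤ 1 := by
    rw [le_div_iff₀ (by positivity)] at hq_le
    linarith
  have hc : (0:ℝ) ≤ q * d := by positivity
  set grid := Fintype.piFinset (fun _ : Fin d => Finset.range (q + 1)) with hgrid
  set f : (Fin d → ℕ) → Finset (Fin n) := fun k => boxIndices x (gridPoint (q * d) k) with hf
  set g : Finset (Fin n) → Finset (Fin n) := fun P => boundaryIndices x (corner x P) with hg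
  have hginj : Set.InjOn g (grid.image f) := by
    intro P hP Q hQ hPQ
    obtain ⟨k, _, rfl⟩ := Finset.mem_image.mp hP
    obtain ⟨l, _, rfl⟩ := Finset.mem_image.mp hQ
    have hk := fun j => (gridPoint_mem_Icc hc k j).1
    have hl := fun j => (gridPoint_mem_Icc hc l j).1
    simp only [hf, hg] at hPQ ⊢
    rw [← boxIndices_corner hk, ← boxIndices_corner hl, ← corner_boundaryIndices hd hk,
      ← corner_boundaryIndices hd hl, hPQ]
  have hupper : ((grid.image f).card : ℝ) ≤ (Real.exp 1 / (2 * ε)) ^ (2 * ε * n) := by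
    rw [← Finset.card_image_of_injOn hginj]
    refine card_le_of_forall_card_le (by positivity) (by linarith) _ fun s hs => ?_
    obtain ⟨P, _, rfl⟩ := Finset.mem_image.mp hs
    exact card_boundaryIndices_le hn hdisc (corner_mem_Icc hx P)
  have hlower : ((q : ℝ) + 1) ^ d ≤ 4 ^ d * (grid.image f).card := by
    have hcard : ((q : ℝ) + 1) ^ d = grid.card := by simp [hgrid]
    rw [hcard, Finset.card_eq_sum_card_image f grid, Nat.cast_sum, mul_comm, ← nsmul_eq_mul]
    exact Finset.sum_le_card_nsmul _ _ _ fun P _ => card_gridPoint_fiber_le hd hq0 hqε hdisc P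
  have hbase : 1 ≤ Real.exp 1 / (2 * ε) := by
    rw [le_div_iff₀ (by positivity)]
    linarith [Real.add_one_le_exp 1]
  have hpow : (1 / (24 * ε)) ^ d ≤ (Real.exp 1 / (2 * ε)) ^ (2 * ε * n) := by
    have : (1 / (6 * ε)) ^ d ≤ 4 ^ d * (Real.exp 1 / (2 * ε)) ^ (2 * ε * n) :=
      calc (1 / (6 * ε)) ^ d ≤ ((q : ℝ) + 1) ^ d := by gcongr
        _ ≤ 4 ^ d * (grid.image f).card := hlower
        _ ≤ _ := by gcongr
    have h4 : 1 / (6 * ε) = 4 * (1 / (24 * ε)) := by field_simp; norm_num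
    rw [h4, mul_pow] at this
    exact le_of_mul_le_mul_left this (by positivity)
  have hsix : ((1 / (24 * ε)) ^ 6) ^ d ≤ (Real.exp 1 / (2 * ε)) ^ d :=
    calc ((1 / (24 * ε)) ^ 6) ^ d = ((1 / (24 * ε)) ^ d) ^ 6 := pow_right_comm _ _ _
      _ ≤ ((Real.exp 1 / (2 * ε)) ^ (2 * ε * n)) ^ 6 := by gcongr
      _ = (Real.exp 1 / (2 * ε)) ^ (12 * ε * n) := by
          rw [← Real.rpow_natCast, ← Real.rpow_mul (by positivity)]
          congr 1
          push_cast
          ring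
      _ ≤ (Real.exp 1 / (2 * ε)) ^ (d : ℝ) := Real.rpow_le_rpow_of_exponent_le hbase hsmall.le
      _ = (Real.exp 1 / (2 * ε)) ^ d := Real.rpow_natCast _ _
  have hle := le_of_pow_le_pow_left₀ (by omega) (by positivity) hsix
  have h5 : ε ^ 5 < (1 / 3000) ^ 5 := pow_lt_pow_left₀ hε1 hε0.le (by norm_num)
  have he := Real.exp_one_lt_d9
  rw [div_pow, one_pow, div_le_div_iff₀ (by positivity) (by positivity)] at hle
  have hfac : 2 * ε ≤ ε * (3 * 24 ^ 6 * ε ^ 5) := by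
    nlinarith [mul_pos (show 0 < 3 - Real.exp 1 by linarith) (pow_pos hε0 6)]
  have := le_of_mul_le_mul_left (show ε * 2 ≤ ε * (3 * 24 ^ 6 * ε ^ 5) by linarith) hε0
  norm_num at h5
  linarith
end
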